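/- Suppose (A1) and (A2) hold and α ∈ (0,π/2). Then for any s > 0 there exist c₀, A ∈ (0,∞) such that: if for some c > c₀ the drift satisfies liminf_{‖x‖→∞} (‖x‖ μ₁(x)) ≥ c and lim_{‖x‖→∞} (‖x‖ μ₂(x)) = 0, then E[τ_α^{(1/2)+s} | ξ₀ = x] = ∞ for all x ∈ W(α) with ‖x‖ ≥ A. -/

import Mathlib

open MeasureTheory
open scoped ENNReal

noncomputable section

/-- Euclidean norm of a lattice point in `ℤ²`. -/
def znorm (x : ℤ × ℤ) : ℝ := Real.sqrt ((x.1 : ℝ) ^ 2 + (x.2 : ℝ) ^ 2)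

/-- Polar angle in `(-π, π]` of a lattice point. -/
def ang (x : ℤ × ℤ) : ℝ := Complex.arg ⟨(x.1 : ℝ), (x.2 : ℝ)⟩

/-- The harmonic function `f_w(x) = r^w cos(w φ)` in polar coordinates. -/
def fw (w : ℝ) (x : ℤ × ℤ) : ℝ := znorm x ^ w * Real.cos (w * ang x)

/-- First component of the mean drift at `x` given jump pmf `p`. -/
def mu1 (p : ℤ × ℤ → ℤ × ℤ → ℝ) (x : ℤ × ℤ) : ℝ := ∑' y : ℤ × ℤ, p x y * (y.1 : ℝ)

/-- Second component of the mean drift at `x`. -/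
def mu2 (p : ℤ × ℤ → ℤ × ℤ → ℝ) (x : ℤ × ℤ) : ℝ := ∑' y : ℤ × ℤ, p x y * (y.2 : ℝ)

/-- Euclidean norm of the mean drift at `x`. -/
def muNorm (p : ℤ × ℤ → ℤ × ℤ → ℝ) (x : ℤ × ℤ) : ℝ :=
  Real.sqrt (mu1 p x ^ 2 + mu2 p x ^ 2)

/-- Second moment `M₁₁(x)`. -/
def M11 (p : ℤ × ℤ → ℤ × ℤ → ℝ) (x : ℤ × ℤ) : ℝ := ∑' y : ℤ × ℤ, p x y * (y.1 : ℝ) ^ 2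

/-- Second moment `M₂₂(x)`. -/
def M22 (p : ℤ × ℤ → ℤ × ℤ → ℝ) (x : ℤ × ℤ) : ℝ := ∑' y : ℤ × ℤ, p x y * (y.2 : ℝ) ^ 2

/-- Mixed second moment `M₁₂(x)`. -/
def M12 (p : ℤ × ℤ → ℤ × ℤ → ℝ) (x : ℤ × ℤ) : ℝ :=
  ∑' y : ℤ × ℤ, p x y * ((y.1 : ℝ) * (y.2 : ℝ))

/-- `p` is a family of probability mass functions on `ℤ²` (the jump laws `θ(x)`). -/
def IsJumpPMF (p : ℤ × ℤ → ℤ × ℤ → ℝ) : Prop :=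
  (∀ x y, 0 ≤ p x y) ∧ ∀ x, HasSum (p x) 1

/-- (A2): jumps are uniformly bounded by `b`: `P[‖θ(x)‖ > b] = 0` for all `x`. -/
def A2 (p : ℤ × ℤ → ℤ × ℤ → ℝ) (b : ℝ) : Prop :=
  ∀ x y, b < znorm y → p x y = 0

section walk

variable {Ω : Type*} [MeasurableSpace Ω]

/-- `ξ` is a time-homogeneous Markov chain with one-step jump law `p`:
conditionally on the past and on `ξ_t = x`, the law of `ξ_{t+1} - ξ_t` is `p x`. -/
def IsMarkovWith (P : Measure Ω) (ξ : ℕ → Ω → ℤ × ℤ) (p : ℤ × ℤ → ℤ × ℤ → ℝ) : Prop :=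
  ∀ (t : ℕ) (x y : ℤ × ℤ) (A : Set Ω),
    MeasurableSet[⨆ s ∈ Finset.range (t + 1), MeasurableSpace.comap (ξ s) ⊤] A →
    P (A ∩ {ω | ξ t ω = x} ∩ {ω | ξ (t + 1) ω = x + y}) =
      ENNReal.ofReal (p x y) * P (A ∩ {ω | ξ t ω = x})

/-- (A1): uniform weak isotropy: from any `x ∈ S`, in `n₀` steps the walk moves by
each of `±k e₁, ±k e₂` with conditional probability at least `κ`. -/
def A1 (P : Measure Ω) (S : Set (ℤ × ℤ)) (ξ : ℕ → Ω → ℤ × ℤ)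
    (κ : ℝ) (k n₀ : ℕ) : Prop :=
  ∀ (t : ℕ), ∀ x ∈ S,
    ∀ y ∈ ({((k : ℤ), (0 : ℤ)), (-(k : ℤ), 0), (0, (k : ℤ)), (0, -(k : ℤ))} : Set (ℤ × ℤ)),
      ENNReal.ofReal κ * P {ω | ξ t ω = x} ≤
        P ({ω | ξ t ω = x} ∩ {ω | ξ (t + n₀) ω = x + y})

/-- First exit time from a region `Wm`, with value `∞` if the walk never leaves. -/
def exitTime (Wm : Set (ℤ × ℤ)) (ξ : ℕ → Ω → ℤ × ℤ) (ω : Ω) : ℝ≥0∞ :=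
  ⨅ (t : ℕ) (_ : ξ t ω ∉ Wm), (t : ℝ≥0∞)

end walk

/-- The wedge `W(α)` for `α ∈ (0,π)`, together with the `α = π` case, where
`W(π) = ℝ² \ H_b` is the complement of the thickened half-line of half-width `b`. -/
def Wset (b α : ℝ) : Set (ℤ × ℤ) :=
  {x | (α < Real.pi ∧ znorm x * Real.cos α < (x.1 : ℝ)) ∨
       (α = Real.pi ∧ ¬ ((x.1 : ℝ) ≤ 0 ∧ |(x.2 : ℝ)| ≤ b))}

/-- The wedge `W(α) = {x : r > 0, -α < φ < α}` in polar form, for `α ∈ (0,π]`. -/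
def WsetArg (α : ℝ) : Set (ℤ × ℤ) :=
  {x | 0 < znorm x ∧ -α < ang x ∧ ang x < α}

end

lemma abs_fst_le_znorm (x : ℤ × ℤ) : |(x.1 : ℝ)| ≤ znorm x :=
  Real.abs_le_sqrt (by nlinarith [sq_nonneg (x.2 : ℝ)])

lemma abs_snd_le_znorm (x : ℤ × ℤ) : |(x.2 : ℝ)| ≤ znorm x :=
  Real.abs_le_sqrt (by nlinarith [sq_nonneg (x.1 : ℝ)])

lemma znorm_eq_norm (x : ℤ × ℤ) : znorm x = ‖(⟨x.1, x.2⟩ : ℂ)‖ := by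
  rw [Complex.norm_eq_sqrt_sq_add_sq, znorm]

lemma znorm_le_add (x y : ℤ × ℤ) : znorm x ≤ znorm (x + y) + znorm y := by
  simp only [znorm_eq_norm]
  have h := norm_sub_le (⟨(x + y).1, (x + y).2⟩ : ℂ) ⟨y.1, y.2⟩
  have e : (⟨(x + y).1, (x + y).2⟩ : ℂ) - ⟨y.1, y.2⟩ = ⟨x.1, x.2⟩ := by
    apply Complex.ext <;> simp
  rwa [e] at h

lemma mem_Wset_iff {b α : ℝ} (hα0 : 0 < α) (hα2 : α < Real.pi / 2) (x : ℤ × ℤ) :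
    x ∈ Wset b α ↔ 0 < (x.1 : ℝ) ∧ |(x.2 : ℝ)| < Real.tan α * x.1 := by
  have hpi : α < Real.pi := by linarith [Real.pi_pos]
  have hcos : 0 < Real.cos α := Real.cos_pos_of_mem_Ioo ⟨by linarith, hα2⟩
  have hsin : 0 < Real.sin α := Real.sin_pos_of_pos_of_lt_pi hα0 hpi
  have hsc := Real.sin_sq_add_cos_sq α
  have hz : znorm x ^ 2 = (x.1 : ℝ) ^ 2 + (x.2 : ℝ) ^ 2 := Real.sq_sqrt (by positivity)
  have hz0 : 0 ≤ znorm x := Real.sqrt_nonneg _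
  have hW : x ∈ Wset b α ↔ znorm x * Real.cos α < (x.1 : ℝ) := by
    simp [Wset, hpi, hpi.ne]
  have hsplit : ((x.1 : ℝ) * Real.sin α) ^ 2 - ((x.2 : ℝ) * Real.cos α) ^ 2
      = (x.1 : ℝ) ^ 2 - (znorm x * Real.cos α) ^ 2 := by
    linear_combination (x.1 : ℝ) ^ 2 * hsc + Real.cos α ^ 2 * hz
  have htan : |(x.2 : ℝ)| < Real.tan α * x.1 ↔
      |(x.2 : ℝ)| * Real.cos α < x.1 * Real.sin α := by
    rw [Real.tan_eq_sin_div_cos, div_mul_eq_mul_div, lt_div_iff₀ hcos, mul_comm (Real.sin α)]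
  have habs : (|(x.2 : ℝ)| * Real.cos α) ^ 2 = ((x.2 : ℝ) * Real.cos α) ^ 2 := by
    rw [mul_pow, sq_abs, mul_pow]
  rw [hW, htan]
  constructor
  · intro h
    have hx : 0 < (x.1 : ℝ) := lt_of_le_of_lt (by positivity) h
    refine ⟨hx, lt_of_pow_lt_pow_left₀ 2 (by positivity) ?_⟩
    have := pow_lt_pow_left₀ h (by positivity) two_ne_zero
    linarith
  · rintro ⟨hx, h⟩
    refine lt_of_pow_lt_pow_left₀ 2 hx.le ?_
    have := pow_lt_pow_left₀ h (by positivity) two_ne_zero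
    linarith

lemma sqrt_one_add_ge {ρ : ℝ} (h : -1 ≤ ρ) :
    1 + ρ / 2 - ρ ^ 2 / 2 ≤ √(1 + ρ) := by
  obtain ⟨s, hs0, rfl⟩ : ∃ s : ℝ, 0 ≤ s ∧ ρ = s ^ 2 - 1 :=
    ⟨√(1 + ρ), Real.sqrt_nonneg _, by rw [Real.sq_sqrt (by linarith)]; ring⟩
  rw [show 1 + (s ^ 2 - 1) = s ^ 2 by ring, Real.sqrt_sq hs0]
  nlinarith [mul_nonneg hs0 (mul_nonneg (by linarith : 0 ≤ s + 2) (sq_nonneg (s - 1)))]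

lemma sqrt_one_add_div_sq_le {ρ : ℝ} (h : -(1 / 2) ≤ ρ) :
    √(1 + ρ) / (1 + ρ) ^ 2 ≤ 1 - 3 * ρ / 2 + 5 * ρ ^ 2 := by
  have hs : √(1 + ρ) ^ 2 = 1 + ρ := Real.sq_sqrt (by linarith)
  have hle : √(1 + ρ) ≤ 1 + ρ / 2 := by
    rw [Real.sqrt_le_left (by linarith)]
    nlinarith [sq_nonneg ρ]
  rw [div_le_iff₀ (by nlinarith)]
  refine hle.trans ?_
  nlinarith [mul_nonneg (sq_nonneg ρ) (by nlinarith [sq_nonneg ρ] : 0 ≤ 3 + 17 * ρ / 2 + 5 * ρ ^ 2)]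

/-- A function of degree `1/2`, positive on `{t² x₁² - x₂² > K}`, which is a submartingale
along walks with a sufficiently strong drift in the direction `e₁`. -/
noncomputable def potential (t K : ℝ) (x : ℤ × ℤ) : ℝ :=
  √(x.1 : ℝ) * (t ^ 2 - ((x.2 : ℝ) ^ 2 + K) / (x.1 : ℝ) ^ 2)

lemma potential_add_ge {t K b : ℝ} (ht : 0 < t) (hK : 0 ≤ K) (x z : ℤ × ℤ)
    (hx1 : 0 < (x.1 : ℝ)) (hxb : 2 * b ≤ x.1) (hxK : (x.2 : ℝ) ^ 2 + K ≤ t ^ 2 * (x.1 : ℝ) ^ 2)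
    (hz1 : |(z.1 : ℝ)| ≤ b) (hz2 : |(z.2 : ℝ)| ≤ b) :
    √(x.1 : ℝ) * ((t ^ 2 / 2 + 3 / 2 * (((x.2 : ℝ) ^ 2 + K) / (x.1 : ℝ) ^ 2)) * (z.1 / x.1)
        - 2 * (x.2 / x.1) * (z.2 / x.1) - b ^ 2 * (6 * t ^ 2 + 8 * t + 3) / (x.1 : ℝ) ^ 2)
      + potential t K x ≤ potential t K (x + z) := by
  obtain ⟨x1, x2⟩ := x
  obtain ⟨z1, z2⟩ := z
  simp only [potential, Prod.mk_add_mk, Int.cast_add] at *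
  generalize (x1 : ℝ) = u at *
  generalize (x2 : ℝ) = v at *
  generalize (z1 : ℝ) = h at *
  generalize (z2 : ℝ) = l at *
  obtain ⟨ρ, rfl⟩ : ∃ ρ, h = u * ρ := ⟨h / u, by field_simp⟩
  obtain ⟨q, rfl⟩ : ∃ q, v = u * q := ⟨v / u, by field_simp⟩
  obtain ⟨m, rfl⟩ : ∃ m, l = u * m := ⟨l / u, by field_simp⟩
  obtain ⟨β, rfl⟩ : ∃ β, b = u * β := ⟨b / u, by field_simp⟩
  obtain ⟨k, rfl⟩ : ∃ k, K = u ^ 2 * k := ⟨K / u ^ 2, by field_simp⟩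
  have hk : 0 ≤ k := nonneg_of_mul_nonneg_right hK (by positivity)
  have hβ : β ≤ 1 / 2 := by nlinarith
  rw [abs_mul, abs_of_pos hx1] at hz1 hz2
  have hρ := le_of_mul_le_mul_left hz1 hx1
  have hm := le_of_mul_le_mul_left hz2 hx1
  have hqk : q ^ 2 + k ≤ t ^ 2 := by
    have : u ^ 2 * (q ^ 2 + k) ≤ u ^ 2 * t ^ 2 := by linarith
    exact le_of_mul_le_mul_left this (by positivity)
  have hq : |q| ≤ t := abs_le_of_sq_le_sq (by linarith) ht.le
  have hρ2 := abs_le.1 (hρ.trans hβ)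
  have e1 : √(u + u * ρ) = √u * √(1 + ρ) := by
    rw [← Real.sqrt_mul hx1.le]; ring_nf
  have e2 : ((u * q + u * m) ^ 2 + u ^ 2 * k) / (u + u * ρ) ^ 2
      = ((q + m) ^ 2 + k) / (1 + ρ) ^ 2 := by
    have : 1 + ρ ≠ 0 := by linarith
    rw [show (u * q + u * m) ^ 2 + u ^ 2 * k = u ^ 2 * ((q + m) ^ 2 + k) by ring,
      show (u + u * ρ) ^ 2 = u ^ 2 * (1 + ρ) ^ 2 by ring,
      mul_div_mul_left _ _ (by positivity)]
  have e3 : ((u * q) ^ 2 + u ^ 2 * k) / u ^ 2 = q ^ 2 + k := by field_simp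
  have e4 : (u * β) ^ 2 * (6 * t ^ 2 + 8 * t + 3) / u ^ 2 = β ^ 2 * (6 * t ^ 2 + 8 * t + 3) := by
    field_simp
  rw [e1, e2, e3, e4, mul_div_cancel_left₀ _ hx1.ne', mul_div_cancel_left₀ _ hx1.ne',
    mul_div_cancel_left₀ _ hx1.ne', mul_assoc (√u) (√(1 + ρ)), ← mul_add]
  refine mul_le_mul_of_nonneg_left ?_ (Real.sqrt_nonneg _)
  have h1 := sqrt_one_add_ge (by linarith : -1 ≤ ρ)
  have h2 := sqrt_one_add_div_sq_le hρ2.1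
  have h3 : √(1 + ρ) * (t ^ 2 - ((q + m) ^ 2 + k) / (1 + ρ) ^ 2)
      = t ^ 2 * √(1 + ρ) - ((q + m) ^ 2 + k) * (√(1 + ρ) / (1 + ρ) ^ 2) := by ring
  have h4 := mul_le_mul_of_nonneg_left h1 (sq_nonneg t)
  have h5 := mul_le_mul_of_nonneg_left h2 (by positivity : 0 ≤ (q + m) ^ 2 + k)
  have hρβ : ρ ^ 2 ≤ β ^ 2 := sq_le_sq' (abs_le.1 hρ).1 (abs_le.1 hρ).2
  have hmβ : m ^ 2 ≤ β ^ 2 := sq_le_sq' (abs_le.1 hm).1 (abs_le.1 hm).2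
  have h6 : (q ^ 2 + k) * ρ ^ 2 ≤ t ^ 2 * β ^ 2 := by gcongr
  have h7 : m ^ 2 * (1 - 3 * ρ / 2 + 5 * ρ ^ 2) ≤ β ^ 2 * 3 := by
    have : ρ ^ 2 ≤ 1 / 4 := by nlinarith
    gcongr
    · nlinarith [sq_nonneg (ρ - 3 / 20)]
    · linarith
  have h8 : 2 * q * m * (5 * ρ ^ 2 - 3 * ρ / 2) ≤ (8 * t * β ^ 2) := by
    have hβ0 : 0 ≤ β := (abs_nonneg _).trans hρ
    have a1 : |5 * ρ - 3 / 2| ≤ 4 := by rw [abs_le]; constructor <;> linarith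
    have a2 : |2 * q * m * (5 * ρ ^ 2 - 3 * ρ / 2)| ≤ 8 * t * β ^ 2 := by
      rw [show 2 * q * m * (5 * ρ ^ 2 - 3 * ρ / 2) = 2 * (q * (m * (ρ * (5 * ρ - 3 / 2)))) by ring]
      simp only [abs_mul, abs_two]
      calc _ ≤ 2 * (t * (β * (β * 4))) := by gcongr
        _ = _ := by ring
    exact (abs_le.1 a2).2
  have h9 := mul_le_mul_of_nonneg_left hρβ (sq_nonneg t)
  rw [h3]
  linarith [sq_nonneg (t * β)]

/-- The lattice points of Euclidean norm at most `b`. -/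
noncomputable def jumps (b : ℝ) : Finset (ℤ × ℤ) :=
  (Finset.Icc (-⌈b⌉) ⌈b⌉ ×ˢ Finset.Icc (-⌈b⌉) ⌈b⌉).filter fun z => znorm z ≤ b

lemma mem_jumps {b : ℝ} {z : ℤ × ℤ} : z ∈ jumps b ↔ znorm z ≤ b := by
  refine ⟨fun h => (Finset.mem_filter.1 h).2, fun h => Finset.mem_filter.2 ⟨?_, h⟩⟩
  have h1 := abs_le.1 (((abs_fst_le_znorm z).trans h).trans (Int.le_ceil b))
  have h2 := abs_le.1 (((abs_snd_le_znorm z).trans h).trans (Int.le_ceil b))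
  simp only [Finset.mem_product, Finset.mem_Icc]
  exact_mod_cast And.intro h1 h2

section jumpSums

variable {p : ℤ × ℤ → ℤ × ℤ → ℝ} {b : ℝ}

lemma sum_jumps_eq_one (hpmf : IsJumpPMF p) (hA2 : A2 p b) (x : ℤ × ℤ) :
    ∑ z ∈ jumps b, p x z = 1 := by
  rw [← (hpmf.2 x).tsum_eq, tsum_eq_sum]
  exact fun z hz => hA2 x z (not_le.1 (mt mem_jumps.2 hz))

lemma mu1_eq_sum (hA2 : A2 p b) (x : ℤ × ℤ) : mu1 p x = ∑ z ∈ jumps b, p x z * (z.1 : ℝ) := by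
  refine tsum_eq_sum fun z hz => ?_
  rw [hA2 x z (not_le.1 (mt mem_jumps.2 hz)), zero_mul]

lemma mu2_eq_sum (hA2 : A2 p b) (x : ℤ × ℤ) : mu2 p x = ∑ z ∈ jumps b, p x z * (z.2 : ℝ) := by
  refine tsum_eq_sum fun z hz => ?_
  rw [hA2 x z (not_le.1 (mt mem_jumps.2 hz)), zero_mul]

lemma sum_jumps_affine (hpmf : IsJumpPMF p) (hA2 : A2 p b) (x : ℤ × ℤ) (c₀ c₁ c₂ : ℝ) :
    ∑ z ∈ jumps b, p x z * (c₀ + c₁ * z.1 + c₂ * z.2) = c₀ + c₁ * mu1 p x + c₂ * mu2 p x := by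
  calc _ = ∑ z ∈ jumps b, (c₀ * p x z + c₁ * (p x z * z.1) + c₂ * (p x z * z.2)) :=
        Finset.sum_congr rfl fun z _ => by ring
    _ = _ := by
      rw [Finset.sum_add_distrib, Finset.sum_add_distrib, ← Finset.mul_sum, ← Finset.mul_sum,
        ← Finset.mul_sum, sum_jumps_eq_one hpmf hA2, mu1_eq_sum hA2, mu2_eq_sum hA2, mul_one]

variable {t g κ : ℝ} {x : ℤ × ℤ}

/-- If the drift at `x` is at least `g / ‖x‖` in the direction `e₁`, some possible jump increases
the quadratic form `t² x₁² - x₂²` by at least `1`. -/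
lemma exists_jump_quadratic_increase (hpmf : IsJumpPMF p) (hA2 : A2 p b)
    (hx1 : 0 < (x.1 : ℝ)) (hκ : 0 < κ)
    (hxκ : znorm x * κ ≤ x.1) (hg : 4 + b ^ 2 ≤ 2 * t ^ 2 * κ * g) (hg0 : 0 ≤ g)
    (hμ1 : g ≤ znorm x * mu1 p x) (hμ2 : |znorm x * mu2 p x| ≤ 1) :
    ∃ z ∈ jumps b, 0 < p x z ∧ t ^ 2 * (x.1 : ℝ) ^ 2 - (x.2 : ℝ) ^ 2 + 1 ≤
      t ^ 2 * ((x + z).1 : ℝ) ^ 2 - ((x + z).2 : ℝ) ^ 2 := by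
  by_contra! hcon
  have hr : 0 < znorm x := hx1.trans_le ((le_abs_self _).trans (abs_fst_le_znorm x))
  have hμ1' : κ * g ≤ x.1 * mu1 p x := by
    have : 0 ≤ mu1 p x := nonneg_of_mul_nonneg_right (hg0.trans hμ1) hr
    nlinarith
  have hμ2' : |x.2 * mu2 p x| ≤ 1 := by
    rw [abs_mul, abs_of_pos hr] at hμ2
    rw [abs_mul]
    exact (mul_le_mul_of_nonneg_right (abs_snd_le_znorm x) (abs_nonneg _)).trans hμ2
  have hle : ∑ z ∈ jumps b, p x z * (-b ^ 2 + (2 * t ^ 2 * x.1) * z.1 + (-2 * x.2) * z.2)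
      ≤ ∑ z ∈ jumps b, p x z := by
    refine Finset.sum_le_sum fun z hz => ?_
    rcases (hpmf.1 x z).eq_or_lt with h | h
    · simp [← h]
    · have h1 := hcon z hz h
      have h2 : (z.2 : ℝ) ^ 2 ≤ b ^ 2 :=
        sq_le_sq' (abs_le.1 ((abs_snd_le_znorm z).trans (mem_jumps.1 hz))).1
          (abs_le.1 ((abs_snd_le_znorm z).trans (mem_jumps.1 hz))).2
      simp only [Prod.fst_add, Prod.snd_add, Int.cast_add] at h1
      refine mul_le_of_le_one_right h.le ?_
      nlinarith [mul_nonneg (sq_nonneg t) (sq_nonneg (z.1 : ℝ))]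
  rw [sum_jumps_affine hpmf hA2, sum_jumps_eq_one hpmf hA2] at hle
  have := (abs_le.1 hμ2').2
  have := mul_le_mul_of_nonneg_left hμ1' (by positivity : 0 ≤ 2 * t ^ 2)
  linarith

lemma potential_le_sum_jumps {K : ℝ} (hpmf : IsJumpPMF p) (hA2 : A2 p b)
    (ht : 0 < t) (hK : 0 ≤ K) (hx1 : 0 < (x.1 : ℝ)) (hxb : 2 * b ≤ x.1)
    (hxK : (x.2 : ℝ) ^ 2 + K ≤ t ^ 2 * (x.1 : ℝ) ^ 2)
    (hκ : 0 < κ) (hxκ : znorm x * κ ≤ x.1)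
    (hg : 2 * (2 * t + b ^ 2 * (6 * t ^ 2 + 8 * t + 3)) ≤ t ^ 2 * κ * g) (hg0 : 0 ≤ g)
    (hμ1 : g ≤ znorm x * mu1 p x) (hμ2 : |znorm x * mu2 p x| ≤ 1) :
    potential t K x ≤ ∑ z ∈ jumps b, p x z * potential t K (x + z) := by
  set u : ℝ := (x.1 : ℝ) with hu
  set a : ℝ := ((x.2 : ℝ) ^ 2 + K) / u ^ 2 with ha
  set C : ℝ := b ^ 2 * (6 * t ^ 2 + 8 * t + 3) with hC
  have hr : u ≤ znorm x := (le_abs_self _).trans (abs_fst_le_znorm x)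
  have hr0 : 0 < znorm x := hx1.trans_le hr
  have ha0 : 0 ≤ a := by positivity
  have hm1 : 0 ≤ mu1 p x := nonneg_of_mul_nonneg_right (hg0.trans hμ1) hr0
  have hμ1' : κ * g ≤ u * mu1 p x := by nlinarith
  have hμ2' : x.2 * mu2 p x ≤ t := by
    have h1 : u * |mu2 p x| ≤ 1 := by
      rw [abs_mul, abs_of_pos hr0] at hμ2
      exact (mul_le_mul_of_nonneg_right hr (abs_nonneg _)).trans hμ2
    have h2 : |(x.2 : ℝ)| ≤ t * u := abs_le_of_sq_le_sq (by linarith) (by positivity)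
    calc x.2 * mu2 p x ≤ |(x.2 : ℝ)| * |mu2 p x| := by
          rw [← abs_mul]; exact le_abs_self _
      _ ≤ t * u * |mu2 p x| := by gcongr
      _ ≤ t := by nlinarith
  have hdrift : 0 ≤ (t ^ 2 / 2 + 3 / 2 * a) * (u * mu1 p x) - 2 * (x.2 * mu2 p x) - C := by
    have h0 : 0 ≤ u * mu1 p x := by positivity
    have h1 := mul_le_mul_of_nonneg_left hμ1' (sq_nonneg t)
    have h2 := mul_nonneg ha0 h0
    linarith
  calc potential t K x
      ≤ √u / u ^ 2 * ((t ^ 2 / 2 + 3 / 2 * a) * (u * mu1 p x) - 2 * (x.2 * mu2 p x) - C)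
        + potential t K x := le_add_of_nonneg_left (by positivity)
    _ = ∑ z ∈ jumps b, p x z * (√u / u ^ 2 * (-C) + potential t K x
        + √u / u ^ 2 * ((t ^ 2 / 2 + 3 / 2 * a) * u) * z.1 + √u / u ^ 2 * (-2 * x.2) * z.2) := by
      rw [sum_jumps_affine hpmf hA2]; ring
    _ ≤ _ := by
      refine Finset.sum_le_sum fun z hz => mul_le_mul_of_nonneg_left ?_ (hpmf.1 x z)
      have hzb := mem_jumps.1 hz
      refine le_trans (le_of_eq ?_) (potential_add_ge ht hK x z hx1 hxb hxK
        ((abs_fst_le_znorm z).trans hzb) ((abs_snd_le_znorm z).trans hzb))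
      rw [← hu, ← ha, ← hC]
      field_simp
      ring

end jumpSums

section chain

variable {Ω : Type*} {ξ : ℕ → Ω → ℤ × ℤ} {b : ℝ}

/-- The `σ`-algebra generated by `ξ 0, …, ξ t`. -/
@[reducible]
def history (ξ : ℕ → Ω → ℤ × ℤ) (t : ℕ) : MeasurableSpace Ω :=
  ⨆ s ∈ Finset.range (t + 1), MeasurableSpace.comap (ξ s) ⊤

lemma history_mono (ξ : ℕ → Ω → ℤ × ℤ) : Monotone (history ξ) := fun s t hst =>
  biSup_mono fun i hi => Finset.mem_range.2 ((Finset.mem_range.1 hi).trans_le (by omega))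

lemma measurableSet_history_eq (ξ : ℕ → Ω → ℤ × ℤ) (t : ℕ) (x : ℤ × ℤ) :
    MeasurableSet[history ξ t] {ω | ξ t ω = x} := by
  have h : MeasurableSpace.comap (ξ t) ⊤ ≤ history ξ t :=
    le_iSup₂_of_le t (Finset.self_mem_range_succ t) le_rfl
  exact h _ ⟨{x}, trivial, rfl⟩

/-- If the walk is at `y` at time `m` and has not left the wedge before, it needs at least
`(t y₁ - |y₂|) / (b (1 + t))` steps to leave the wedge. -/
lemma le_exitTime_of_jumps_le {α δ : ℝ} (hα0 : 0 < α) (hα2 : α < Real.pi / 2) (hb : 0 < b)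
    {ω : Ω} (hω : ∀ t, znorm (ξ (t + 1) ω - ξ t ω) ≤ b) (m : ℕ)
    (hpast : ∀ j < m, ξ j ω ∈ Wset b α)
    (hδ : b * (1 + Real.tan α) * δ = Real.tan α * ((ξ m ω).1 : ℝ) - |((ξ m ω).2 : ℝ)|)
    (hdeep : b * δ ≤ ((ξ m ω).1 : ℝ)) :
    ENNReal.ofReal δ ≤ exitTime (Wset b α) ξ ω := by
  have htan : 0 < Real.tan α := Real.tan_pos_of_pos_of_lt_pi_div_two hα0 hα2
  have hinc : ∀ i : ℕ, ((ξ m ω).1 : ℝ) - i * b ≤ (ξ (m + i) ω).1 ∧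
      |((ξ (m + i) ω).2 : ℝ)| ≤ |((ξ m ω).2 : ℝ)| + i * b := by
    intro i
    induction i with
    | zero => simp
    | succ i ih =>
      have h1 := (abs_le.1 ((abs_fst_le_znorm _).trans (hω (m + i)))).1
      have h2 := (abs_snd_le_znorm _).trans (hω (m + i))
      simp only [Prod.fst_sub, Prod.snd_sub, Int.cast_sub] at h1 h2
      have h3 := abs_sub_abs_le_abs_sub ((ξ (m + i + 1) ω).2 : ℝ) (ξ (m + i) ω).2
      push_cast
      rw [← add_assoc]
      constructor <;> linarith [ih.1, ih.2]
  refine le_iInf₂ fun j hj => ?_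
  rw [← ENNReal.ofReal_natCast]
  refine ENNReal.ofReal_le_ofReal ?_
  by_contra! hlt
  obtain ⟨i, rfl⟩ : ∃ i, j = m + i := Nat.exists_eq_add_of_le (not_lt.1 (mt (hpast j) hj))
  push_cast at hlt
  have hi : (i : ℝ) < δ := by linarith [(Nat.cast_nonneg m : (0 : ℝ) ≤ m)]
  have hib : i * b < b * δ := by nlinarith
  refine hj ((mem_Wset_iff hα0 hα2 _).2 ⟨by linarith [(hinc i).1], ?_⟩)
  have h1 := mul_le_mul_of_nonneg_left (hinc i).1 htan.le
  have h2 := mul_lt_mul_of_pos_left hib (by linarith : 0 < 1 + Real.tan α)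
  linarith [(hinc i).2]

variable [mΩ : MeasurableSpace Ω] {P : Measure Ω} {p : ℤ × ℤ → ℤ × ℤ → ℝ}

lemma history_le (hmeas : ∀ t, Measurable (ξ t)) (t : ℕ) :
    history ξ t ≤ mΩ :=
  iSup₂_le fun s _ => by
    rintro _ ⟨B, -, rfl⟩
    exact hmeas s (MeasurableSet.of_discrete)

lemma ae_znorm_sub_le (hMarkov : IsMarkovWith P ξ p) (hA2 : A2 p b) :
    ∀ᵐ ω ∂P, ∀ t, znorm (ξ (t + 1) ω - ξ t ω) ≤ b := by
  refine ae_all_iff.2 fun t => ?_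
  have h : ∀ x y : ℤ × ℤ, b < znorm y → ∀ᵐ ω ∂P, ¬ (ξ t ω = x ∧ ξ (t + 1) ω = x + y) := by
    intro x y hy
    have := hMarkov t x y Set.univ MeasurableSet.univ
    rw [hA2 x y hy, ENNReal.ofReal_zero, zero_mul] at this
    rw [ae_iff]
    simpa [Set.inter_def] using this
  have h' : ∀ᵐ ω ∂P, ∀ x y : ℤ × ℤ, b < znorm y → ¬ (ξ t ω = x ∧ ξ (t + 1) ω = x + y) :=
    ae_all_iff.2 fun x => ae_all_iff.2 fun y => Filter.eventually_imp_distrib_left.2 (h x y)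
  filter_upwards [h'] with ω hω
  by_contra! hlt
  exact hω (ξ t ω) (ξ (t + 1) ω - ξ t ω) hlt ⟨rfl, by abel⟩

lemma ofReal_mul_measure_le_setLIntegral_rpow {E : Set Ω} (hE : MeasurableSet E)
    {g : Ω → ℝ≥0∞} {a c δ q : ℝ} (hc : 0 ≤ c) (hδ : 0 ≤ δ) (hq : 0 ≤ q) (hle : a ≤ c * δ ^ q)
    (h : ∀ᵐ ω ∂P, ω ∈ E → ENNReal.ofReal δ ≤ g ω) :
    ENNReal.ofReal a * P E ≤ ENNReal.ofReal c * ∫⁻ ω in E, g ω ^ q ∂P := by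
  calc ENNReal.ofReal a * P E ≤ ENNReal.ofReal (c * δ ^ q) * P E := by gcongr
    _ = ENNReal.ofReal c * ∫⁻ _ in E, ENNReal.ofReal δ ^ q ∂P := by
      rw [setLIntegral_const, ENNReal.ofReal_mul hc, ENNReal.ofReal_rpow_of_nonneg hδ hq, mul_assoc]
    _ ≤ _ := by
      refine mul_le_mul_right ?_ _
      refine setLIntegral_mono_ae' hE ?_
      filter_upwards [h] with ω hω hωE
      exact ENNReal.rpow_le_rpow (hω hωE) hq


lemma mem_cone_of_potential_pos {t K : ℝ} {y : ℤ × ℤ} (hy1 : 0 < (y.1 : ℝ))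
    (h : 0 < potential t K y) : (y.2 : ℝ) ^ 2 + K < t ^ 2 * (y.1 : ℝ) ^ 2 := by
  have h1 : 0 < t ^ 2 - ((y.2 : ℝ) ^ 2 + K) / (y.1 : ℝ) ^ 2 :=
    pos_of_mul_pos_right h (Real.sqrt_nonneg _)
  rwa [sub_pos, div_lt_iff₀ (by positivity)] at h1

lemma mem_Wset_of_potential_pos {α K : ℝ} {y : ℤ × ℤ} (hα0 : 0 < α) (hα2 : α < Real.pi / 2)
    (hK : 0 ≤ K) (hy1 : 0 < (y.1 : ℝ)) (h : 0 < potential (Real.tan α) K y) : y ∈ Wset b α := by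
  have htan : 0 < Real.tan α := Real.tan_pos_of_pos_of_lt_pi_div_two hα0 hα2
  refine (mem_Wset_iff hα0 hα2 y).2 ⟨hy1, abs_lt_of_sq_lt_sq ?_ (by positivity)⟩
  rw [mul_pow]
  linarith [mem_cone_of_potential_pos hy1 h]

lemma potential_le_sqrt {t K : ℝ} {y : ℤ × ℤ} (hK : 0 ≤ K) :
    potential t K y ≤ t ^ 2 * √(y.1 : ℝ) := by
  rw [potential, mul_comm]
  gcongr
  exact sub_le_self _ (by positivity)

lemma potential_le_depth {t K : ℝ} {y : ℤ × ℤ} (hK : 0 ≤ K) (hy1 : 0 < (y.1 : ℝ))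
    (hy2 : |(y.2 : ℝ)| ≤ t * y.1) :
    potential t K y ≤ 2 * t * (t * y.1 - |(y.2 : ℝ)|) / √(y.1 : ℝ) := by
  rw [potential, le_div_iff₀ (Real.sqrt_pos.2 hy1), mul_right_comm, Real.mul_self_sqrt hy1.le,
    ← mul_le_mul_iff_right₀ hy1]
  have h : (y.1 : ℝ) * (y.1 * (t ^ 2 - ((y.2 : ℝ) ^ 2 + K) / (y.1 : ℝ) ^ 2))
      = t ^ 2 * (y.1 : ℝ) ^ 2 - |(y.2 : ℝ)| ^ 2 - K := by
    rw [sq_abs]; field_simp; ring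
  rw [h]
  nlinarith

lemma mul_div_sqrt_le_rpow {n u d q : ℝ} (hn : 0 < n) (hnu : n ≤ u) (hd : 0 < d)
    (hdu : d ≤ u) (hq : 1 / 2 ≤ q) (hq1 : q ≤ 1) : d / √u ≤ n ^ (1 / 2 - q) * d ^ q := by
  have hu : 0 < u := hn.trans_le hnu
  calc d / √u = d ^ q * d ^ (1 - q) * u ^ (-(1 / 2) : ℝ) := by
        rw [← Real.rpow_add hd, add_sub_cancel, Real.rpow_one, Real.rpow_neg hu.le,
          ← Real.sqrt_eq_rpow, div_eq_mul_inv]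
    _ ≤ d ^ q * u ^ (1 - q) * u ^ (-(1 / 2) : ℝ) := by
        gcongr
    _ = d ^ q * u ^ (1 / 2 - q) := by
        rw [mul_assoc, ← Real.rpow_add hu]; ring_nf
    _ ≤ d ^ q * n ^ (1 / 2 - q) := by
        refine mul_le_mul_of_nonneg_left ?_ (by positivity)
        exact Real.rpow_le_rpow_of_nonpos hn hnu (by linarith)
    _ = _ := mul_comm _ _

lemma potential_mul_measure_le_of_le_fst {α K q : ℝ} (hα0 : 0 < α) (hα2 : α < Real.pi / 2)
    (hb : 0 < b) (hK : 0 ≤ K) (hq : 1 / 2 ≤ q) (hq1 : q ≤ 1)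
    (hmeas : ∀ t, Measurable (ξ t)) (hMarkov : IsMarkovWith P ξ p) (hA2 : A2 p b)
    {n m : ℕ} (hn : 0 < n) {A : Set Ω} {y : ℤ × ℤ} (hA : MeasurableSet[history ξ m] A)
    (hpast : ∀ ω ∈ A, ∀ j < m, ξ j ω ∈ Wset b α) (hny : (n : ℝ) ≤ y.1)
    (hpos : 0 < potential (Real.tan α) K y) :
    ENNReal.ofReal (potential (Real.tan α) K y) * P (A ∩ {ω | ξ m ω = y}) ≤
      ENNReal.ofReal ((Real.tan α ^ 2 + 2 * Real.tan α * (1 + Real.tan α) * b ^ q)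
          * (n : ℝ) ^ (1 / 2 - q))
        * ∫⁻ ω in A ∩ {ω | ξ m ω = y}, exitTime (Wset b α) ξ ω ^ q ∂P := by
  have htan : 0 < Real.tan α := Real.tan_pos_of_pos_of_lt_pi_div_two hα0 hα2
  have hn0 : (0 : ℝ) < n := by exact_mod_cast hn
  have hy1 := hn0.trans_le hny
  have hyW := ((mem_Wset_iff hα0 hα2 y).1 (mem_Wset_of_potential_pos (b := b) hα0 hα2 hK hy1 hpos)).2
  set t := Real.tan α
  obtain ⟨δ, hδ⟩ : ∃ δ, b * (1 + t) * δ = t * y.1 - |(y.2 : ℝ)| :=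
    ⟨(t * y.1 - |(y.2 : ℝ)|) / (b * (1 + t)), by field_simp⟩
  have hδ0 : 0 < δ :=
    pos_of_mul_pos_right (hδ.symm ▸ sub_pos.2 hyW) (by positivity)
  have hbδ : b * δ ≤ y.1 := by
    refine le_of_mul_le_mul_left ?_ (by positivity : 0 < 1 + t)
    linarith [abs_nonneg (y.2 : ℝ)]
  refine ofReal_mul_measure_le_setLIntegral_rpow
    ((history_le hmeas m _ hA).inter (hmeas m (measurableSet_singleton y))) (by positivity) hδ0.le
    (by linarith) ?_ ?_
  · calc potential t K y ≤ 2 * t * (t * y.1 - |(y.2 : ℝ)|) / √(y.1 : ℝ) :=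
          potential_le_depth hK hy1 hyW.le
      _ = 2 * t * (1 + t) * (b * δ / √(y.1 : ℝ)) := by rw [← hδ]; ring
      _ ≤ 2 * t * (1 + t) * ((n : ℝ) ^ (1 / 2 - q) * (b * δ) ^ q) := by
          gcongr
          exact mul_div_sqrt_le_rpow hn0 hny (by positivity) hbδ hq hq1
      _ = 2 * t * (1 + t) * b ^ q * (n : ℝ) ^ (1 / 2 - q) * δ ^ q := by
          rw [Real.mul_rpow hb.le hδ0.le]; ring
      _ ≤ _ := by
          gcongr
          exact le_add_of_nonneg_left (by positivity)
  · filter_upwards [ae_znorm_sub_le hMarkov hA2] with ω hω hωE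
    obtain ⟨hωA, hωy⟩ := hωE
    have hωy : ξ m ω = y := hωy
    exact le_exitTime_of_jumps_le hα0 hα2 hb hω m (hpast ω hωA) (by rw [hωy, hδ]) (by rwa [hωy])

lemma potential_mul_measure_le_of_le_time {α K q : ℝ} (hα0 : 0 < α) (hα2 : α < Real.pi / 2)
    (hb : 0 < b) (hK : 0 ≤ K) (hq : 0 ≤ q)
    (hmeas : ∀ t, Measurable (ξ t))
    {n m : ℕ} (hn : 0 < n) {A : Set Ω} {y : ℤ × ℤ} (hA : MeasurableSet[history ξ m] A)
    (hpast : ∀ ω ∈ A, ∀ j < m, ξ j ω ∈ Wset b α) (hny : (y.1 : ℝ) ≤ n) (hnm : n ≤ m) :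
    ENNReal.ofReal (potential (Real.tan α) K y) * P (A ∩ {ω | ξ m ω = y}) ≤
      ENNReal.ofReal ((Real.tan α ^ 2 + 2 * Real.tan α * (1 + Real.tan α) * b ^ q)
          * (n : ℝ) ^ (1 / 2 - q))
        * ∫⁻ ω in A ∩ {ω | ξ m ω = y}, exitTime (Wset b α) ξ ω ^ q ∂P := by
  have htan : 0 < Real.tan α := Real.tan_pos_of_pos_of_lt_pi_div_two hα0 hα2
  have hn0 : (0 : ℝ) < n := by exact_mod_cast hn
  set t := Real.tan α
  refine ofReal_mul_measure_le_setLIntegral_rpow (δ := n)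
    ((history_le hmeas m _ hA).inter (hmeas m (measurableSet_singleton y))) (by positivity) hn0.le
    hq ?_ ?_
  · rw [mul_assoc, ← Real.rpow_add hn0, sub_add_cancel, ← Real.sqrt_eq_rpow]
    calc potential t K y ≤ t ^ 2 * √(y.1 : ℝ) := potential_le_sqrt hK
      _ ≤ t ^ 2 * √(n : ℝ) := by gcongr
      _ ≤ _ := by
          gcongr
          exact le_add_of_nonneg_right (by positivity)
  · refine ae_of_all _ fun ω hωE => le_iInf₂ fun j hj => ?_
    rw [ENNReal.ofReal_natCast]
    exact_mod_cast hnm.trans (not_lt.1 (mt (hpast ω hωE.1 j) hj))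

/-- On the event that the walk is at `y` at time `m` without having left the wedge, the potential
at `y` bounds the `q`-th moment of the exit time from below, at spatial scale `n`. -/
lemma potential_mul_measure_le {S : Set (ℤ × ℤ)} {α K q : ℝ} (hα0 : 0 < α)
    (hα2 : α < Real.pi / 2) (hb : 0 < b) (hK : 0 ≤ K) (hq : 1 / 2 ≤ q) (hq1 : q ≤ 1)
    (hmeas : ∀ t, Measurable (ξ t)) (hinS : ∀ t, ∀ᵐ ω ∂P, ξ t ω ∈ S)
    (hMarkov : IsMarkovWith P ξ p) (hpmf : IsJumpPMF p) (hA2 : A2 p b)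
    (hsub : ∀ y ∈ S, 0 < (y.1 : ℝ) → 0 < potential (Real.tan α) K y → b < y.1 ∧
      potential (Real.tan α) K y ≤ ∑ z ∈ jumps b, p y z * potential (Real.tan α) K (y + z))
    {n : ℕ} (hn : 0 < n) :
    ∀ (N m : ℕ) (A : Set Ω) (y : ℤ × ℤ), n ≤ m + N → MeasurableSet[history ξ m] A →
      (∀ ω ∈ A, ∀ j < m, ξ j ω ∈ Wset b α) → 0 < (y.1 : ℝ) → (y.1 : ℝ) ≤ n + b →
      ENNReal.ofReal (potential (Real.tan α) K y) * P (A ∩ {ω | ξ m ω = y}) ≤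
        ENNReal.ofReal ((Real.tan α ^ 2 + 2 * Real.tan α * (1 + Real.tan α) * b ^ q)
            * (n : ℝ) ^ (1 / 2 - q))
          * ∫⁻ ω in A ∩ {ω | ξ m ω = y}, exitTime (Wset b α) ξ ω ^ q ∂P := by
  have htan : 0 < Real.tan α := Real.tan_pos_of_pos_of_lt_pi_div_two hα0 hα2
  set t := Real.tan α 
  have hn0 : (0 : ℝ) < n := by exact_mod_cast hn
  have hC1 : 0 ≤ 2 * t * (1 + t) * b ^ q := by positivity
  have hC : 0 ≤ (t ^ 2 + 2 * t * (1 + t) * b ^ q) * (n : ℝ) ^ (1 / 2 - q) := by positivity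
  intro N
  induction N with
  | zero =>
    intro m A y hnm hA hpast hy1 hyn
    rcases le_total (n : ℝ) y.1 with hny | hny
    · rcases le_or_gt (potential t K y) 0 with hpos | hpos
      · simp [ENNReal.ofReal_eq_zero.2 hpos]
      · exact potential_mul_measure_le_of_le_fst hα0 hα2 hb hK hq hq1 hmeas hMarkov hA2 hn hA
          hpast hny hpos
    · exact potential_mul_measure_le_of_le_time hα0 hα2 hb hK (by linarith) hmeas hn hA hpast hny
        hnm
  | succ N ih =>
    intro m A y hnm hA hpast hy1 hyn
    rcases le_or_gt (potential t K y) 0 with hpos | hpos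
    · simp [ENNReal.ofReal_eq_zero.2 hpos]
    rcases le_total (n : ℝ) y.1 with hny | hny
    · exact potential_mul_measure_le_of_le_fst hα0 hα2 hb hK hq hq1 hmeas hMarkov hA2 hn hA
        hpast hny hpos
    set E : Set Ω := A ∩ {ω | ξ m ω = y} with hE
    rcases eq_or_ne (P E) 0 with hPE | hPE
    · simp [hPE]
    have hyS : y ∈ S := by
      by_contra hyS
      refine hPE (measure_mono_null ?_ (ae_iff.1 (hinS m)))
      rintro ω ⟨-, rfl⟩
      exact hyS
    obtain ⟨hby, hsum⟩ := hsub y hyS hy1 hpos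
    have hEm : MeasurableSet[history ξ m] E :=
      MeasurableSet.inter (m := history ξ m) hA (measurableSet_history_eq ξ m y)
    have hEpast : ∀ ω ∈ E, ∀ j < m + 1, ξ j ω ∈ Wset b α := by
      rintro ω ⟨hωA, hωy⟩ j hj
      rcases Nat.lt_succ_iff_lt_or_eq.1 hj with hj | rfl
      · exact hpast ω hωA j hj
      · exact (show ξ j ω = y from hωy) ▸ mem_Wset_of_potential_pos hα0 hα2 hK hy1 hpos
    have hstep : ∀ z ∈ jumps b, ENNReal.ofReal (p y z * potential t K (y + z)) * P E ≤
        ENNReal.ofReal ((t ^ 2 + 2 * t * (1 + t) * b ^ q) * (n : ℝ) ^ (1 / 2 - q))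
          * ∫⁻ ω in E ∩ {ω | ξ (m + 1) ω = y + z}, exitTime (Wset b α) ξ ω ^ q ∂P := by
      intro z hz
      have hz1 := abs_le.1 ((abs_fst_le_znorm z).trans (mem_jumps.1 hz))
      rw [ENNReal.ofReal_mul (hpmf.1 y z), mul_comm (ENNReal.ofReal (p y z)), mul_assoc, hE,
        ← hMarkov m y z A hA, ← hE]
      refine ih (m + 1) E (y + z) (by omega) (history_mono ξ (Nat.le_succ m) _ hEm) hEpast ?_ ?_
      all_goals
        rw [Prod.fst_add, Int.cast_add]
        linarith
    calc ENNReal.ofReal (potential t K y) * P E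
        ≤ (∑ z ∈ jumps b, ENNReal.ofReal (p y z * potential t K (y + z))) * P E := by
          gcongr
          exact (ENNReal.ofReal_le_ofReal hsum).trans
            (Finset.le_sum_of_subadditive ENNReal.ofReal ENNReal.ofReal_zero.le
              (fun _ _ => ENNReal.ofReal_add_le) _ _)
      _ ≤ ∑ z ∈ jumps b,
          ENNReal.ofReal ((t ^ 2 + 2 * t * (1 + t) * b ^ q) * (n : ℝ) ^ (1 / 2 - q))
          * ∫⁻ ω in E ∩ {ω | ξ (m + 1) ω = y + z}, exitTime (Wset b α) ξ ω ^ q ∂P := by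
          rw [Finset.sum_mul]
          exact Finset.sum_le_sum hstep
      _ = ENNReal.ofReal ((t ^ 2 + 2 * t * (1 + t) * b ^ q) * (n : ℝ) ^ (1 / 2 - q))
          * ∫⁻ ω in ⋃ z ∈ jumps b, E ∩ {ω | ξ (m + 1) ω = y + z},
            exitTime (Wset b α) ξ ω ^ q ∂P := by
          rw [← Finset.mul_sum, lintegral_biUnion_finset]
          · intro z _ z' _ hzz'
            refine Set.disjoint_left.2 fun ω h h' => hzz' ?_
            exact add_left_cancel ((show ξ (m + 1) ω = y + z from h.2).symm.trans h'.2)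
          · exact fun z _ => (history_le hmeas m _ hEm).inter
              (hmeas (m + 1) (measurableSet_singleton (y + z)))
      _ ≤ _ := by
          gcongr
          exact Set.iUnion₂_subset fun z _ => Set.inter_subset_left

/-- From any starting point of the wedge far from the origin, the walk can reach
`{t² x₁² - x₂² ≥ M}` without leaving the wedge. -/
lemma exists_event_reaching_cone {S : Set (ℤ × ℤ)} {α R : ℝ} (hα0 : 0 < α)
    (hα2 : α < Real.pi / 2) (hb : 0 ≤ b) (hinS : ∀ t, ∀ᵐ ω ∂P, ξ t ω ∈ S) (hMarkov : IsMarkovWith P ξ p)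
    (hbR : b ≤ R * Real.cos α)
    (hincr : ∀ y ∈ S, y ∈ Wset b α → R ≤ znorm y → ∃ z ∈ jumps b, 0 < p y z ∧
      Real.tan α ^ 2 * (y.1 : ℝ) ^ 2 - (y.2 : ℝ) ^ 2 + 1 ≤
        Real.tan α ^ 2 * ((y + z).1 : ℝ) ^ 2 - ((y + z).2 : ℝ) ^ 2)
    (M : ℕ) {x : ℤ × ℤ} (hxW : x ∈ Wset b α) (hxR : R + b * M ≤ znorm x)
    (hPx : P {ω | ξ 0 ω = x} ≠ 0) :
    ∀ m ≤ M, ∃ (E : Set Ω) (y : ℤ × ℤ), MeasurableSet[history ξ m] E ∧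
      E ⊆ {ω | ξ 0 ω = x} ∧ E ⊆ {ω | ξ m ω = y} ∧ P E ≠ 0 ∧
      (∀ ω ∈ E, ∀ j < m, ξ j ω ∈ Wset b α) ∧ y ∈ Wset b α ∧
      R + b * M ≤ znorm y + b * m ∧
      m ≤ Real.tan α ^ 2 * (y.1 : ℝ) ^ 2 - (y.2 : ℝ) ^ 2 := by
  have hcos : 0 < Real.cos α := Real.cos_pos_of_mem_Ioo ⟨by linarith, hα2⟩
  have htan : 0 < Real.tan α := Real.tan_pos_of_pos_of_lt_pi_div_two hα0 hα2
  have hquad : ∀ y : ℤ × ℤ, 0 < (y.1 : ℝ) →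
      0 < Real.tan α ^ 2 * (y.1 : ℝ) ^ 2 - (y.2 : ℝ) ^ 2 → y ∈ Wset b α := by
    refine fun y hy h => (mem_Wset_iff hα0 hα2 y).2 ⟨hy, abs_lt_of_sq_lt_sq ?_ (by positivity)⟩
    rw [mul_pow]
    linarith
  intro m
  induction m with
  | zero =>
    refine fun _ => ⟨{ω | ξ 0 ω = x}, x, measurableSet_history_eq ξ 0 x, subset_rfl, subset_rfl,
      hPx, by simp, hxW, by simpa using hxR, ?_⟩
    obtain ⟨hx1, hx2⟩ := (mem_Wset_iff hα0 hα2 x).1 hxW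
    have := pow_lt_pow_left₀ hx2 (abs_nonneg _) two_ne_zero
    rw [sq_abs, mul_pow] at this
    push_cast
    linarith
  | succ m ih =>
    intro hm
    obtain ⟨E, y, hE, hEx, hEy, hPE, hpast, hyW, hyR, hyq⟩ := ih (by omega)
    have hmM : b * (m + 1) ≤ b * M := mul_le_mul_of_nonneg_left (by exact_mod_cast hm) hb
    have hyS : y ∈ S := by
      by_contra hyS
      refine hPE (measure_mono_null (fun ω hω => ?_) (ae_iff.1 (hinS m)))
      rwa [Set.mem_ofPred_eq, show ξ m ω = y from hEy hω]
    obtain ⟨z, hz, hpz, hincz⟩ := hincr y hyS hyW (by linarith)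
    have hyb : b < y.1 := by
      have h : znorm y * Real.cos α < y.1 := by
        simpa [Wset, (show α < Real.pi by linarith [Real.pi_pos]),
          (show α ≠ Real.pi by linarith [Real.pi_pos])] using hyW
      nlinarith
    have hy1 : 0 < ((y + z).1 : ℝ) := by
      have := abs_le.1 ((abs_fst_le_znorm z).trans (mem_jumps.1 hz))
      rw [Prod.fst_add, Int.cast_add]
      linarith
    have hnorm := znorm_le_add y z
    have hzb := mem_jumps.1 hz
    refine ⟨E ∩ {ω | ξ (m + 1) ω = y + z}, y + z, ?_, Set.inter_subset_left.trans hEx,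
      Set.inter_subset_right, ?_, ?_, hquad _ hy1 ?_, ?_, ?_⟩
    · exact MeasurableSet.inter (m := history ξ (m + 1)) (history_mono ξ (Nat.le_succ m) _ hE)
        (measurableSet_history_eq ξ (m + 1) (y + z))
    · have h := hMarkov m y z E hE
      rw [Set.inter_eq_left.2 hEy] at h
      rw [h]
      exact mul_ne_zero (ENNReal.ofReal_pos.2 hpz).ne' hPE
    · rintro ω ⟨hωE, -⟩ j hj
      rcases Nat.lt_succ_iff_lt_or_eq.1 hj with hj | rfl
      · exact hpast ω hωE j hj
      · exact (show ξ j ω = y from hEy hωE) ▸ hyW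
    · linarith [(Nat.cast_nonneg m : (0 : ℝ) ≤ m)]
    · push_cast
      linarith
    · push_cast at *
      linarith

end chain

lemma setLIntegral_exitTime_rpow_eq_top {Ω : Type*} [MeasurableSpace Ω] {P : Measure Ω}
    {ξ : ℕ → Ω → ℤ × ℤ} {p : ℤ × ℤ → ℤ × ℤ → ℝ} {b : ℝ}
    {S : Set (ℤ × ℤ)} {α K q : ℝ} (hα0 : 0 < α)
    (hα2 : α < Real.pi / 2) (hb : 0 < b) (hK : 0 ≤ K) (hq : 1 / 2 < q) (hq1 : q ≤ 1)
    (hmeas : ∀ t, Measurable (ξ t)) (hinS : ∀ t, ∀ᵐ ω ∂P, ξ t ω ∈ S)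
    (hMarkov : IsMarkovWith P ξ p) (hpmf : IsJumpPMF p) (hA2 : A2 p b)
    (hsub : ∀ y ∈ S, 0 < (y.1 : ℝ) → 0 < potential (Real.tan α) K y → b < y.1 ∧
      potential (Real.tan α) K y ≤ ∑ z ∈ jumps b, p y z * potential (Real.tan α) K (y + z))
    {m : ℕ} {E : Set Ω} {y : ℤ × ℤ} (hE : MeasurableSet[history ξ m] E)
    (hEy : E ⊆ {ω | ξ m ω = y}) (hPE : P E ≠ 0) (hpast : ∀ ω ∈ E, ∀ j < m, ξ j ω ∈ Wset b α)
    (hy1 : 0 < (y.1 : ℝ)) (hy : 0 < potential (Real.tan α) K y) :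
    ∫⁻ ω in E, exitTime (Wset b α) ξ ω ^ q ∂P = ⊤ := by
  by_contra htop
  set I := ∫⁻ ω in E, exitTime (Wset b α) ξ ω ^ q ∂P
  set C := Real.tan α ^ 2 + 2 * Real.tan α * (1 + Real.tan α) * b ^ q
  have hlim : Filter.Tendsto (fun n : ℕ => ENNReal.ofReal (C * (n : ℝ) ^ (1 / 2 - q)) * I)
      Filter.atTop (nhds 0) := by
    have h1 : Filter.Tendsto (fun n : ℕ => C * (n : ℝ) ^ (1 / 2 - q)) Filter.atTop (nhds 0) := by
      have := ((tendsto_rpow_neg_atTop (sub_pos.2 hq)).comp tendsto_natCast_atTop_atTop).const_mul C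
      simpa [Function.comp_def] using this
    have h2 := ENNReal.Tendsto.mul_const (ENNReal.tendsto_ofReal h1) (Or.inr htop)
    simpa using h2
  have hle : ∀ᶠ n : ℕ in Filter.atTop, ENNReal.ofReal (potential (Real.tan α) K y) * P E ≤
      ENNReal.ofReal (C * (n : ℝ) ^ (1 / 2 - q)) * I := by
    filter_upwards [Filter.eventually_gt_atTop 0,
      tendsto_natCast_atTop_atTop.eventually_ge_atTop (y.1 : ℝ)] with n hn hyn
    have := potential_mul_measure_le hα0 hα2 hb hK hq.le hq1 hmeas hinS hMarkov hpmf hA2 hsub hn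
      n m E y (by omega) hE hpast hy1 (by linarith)
    rwa [Set.inter_eq_left.2 hEy] at this
  have h0 := ge_of_tendsto hlim hle
  have : ENNReal.ofReal (potential (Real.tan α) K y) * P E ≠ 0 :=
    mul_ne_zero (ENNReal.ofReal_pos.2 hy).ne' hPE
  exact this (le_zero_iff.1 h0)

/-- Theorem 2.3: under (A1), (A2) and `α ∈ (0,π/2)`, for any `s > 0`
there are `c₀, A ∈ (0,∞)` such that if for some `c > c₀` the drift satisfies
`liminf ‖x‖μ₁(x) ≥ c` and `lim ‖x‖μ₂(x) = 0`, then `E[τ_α^{1/2+s} ∣ ξ₀ = x] = ∞`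
for all `x ∈ W(α)` with `‖x‖ ≥ A`. -/
theorem exit_time_half_moment_infinite
    {Ω : Type*} [MeasurableSpace Ω] (P : Measure Ω) [IsProbabilityMeasure P]
    (S : Set (ℤ × ℤ)) (hSunb : ∀ R : ℝ, ∃ x ∈ S, R < znorm x)
    (ξ : ℕ → Ω → ℤ × ℤ) (hmeas : ∀ t, Measurable (ξ t))
    (hinS : ∀ t, ∀ᵐ ω ∂P, ξ t ω ∈ S)
    (p : ℤ × ℤ → ℤ × ℤ → ℝ) (hpmf : IsJumpPMF p)
    (hMarkov : IsMarkovWith P ξ p)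
    (κ : ℝ) (k n₀ : ℕ) (hκ : 0 < κ) (hk : 0 < k) (hn₀ : 0 < n₀)
    (hA1 : A1 P S ξ κ k n₀)
    (b : ℝ) (hb : 0 < b) (hA2 : A2 p b)
    (α : ℝ) (hα0 : 0 < α) (hα2 : α < Real.pi / 2) :
    ∀ s : ℝ, 0 < s → ∃ c₀ A : ℝ, 0 < c₀ ∧ 0 < A ∧
      ∀ c : ℝ, c₀ < c →
        (∀ ε : ℝ, 0 < ε → ∃ r₁ : ℝ, ∀ x ∈ S, r₁ ≤ znorm x →
          c - ε ≤ znorm x * mu1 p x) →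
        (∀ ε : ℝ, 0 < ε → ∃ r₁ : ℝ, ∀ x ∈ S, r₁ ≤ znorm x →
          |znorm x * mu2 p x| ≤ ε) →
        ∀ x ∈ Wset b α, A ≤ znorm x → P {ω | ξ 0 ω = x} ≠ 0 →
          ∫⁻ ω in {ω | ξ 0 ω = x}, exitTime (Wset b α) ξ ω ^ (1 / 2 + s) ∂P = ⊤ := by
  intro s hs
  have hpi := Real.pi_pos
  have hcos : 0 < Real.cos α := Real.cos_pos_of_mem_Ioo ⟨by linarith, hα2⟩
  have htan : 0 < Real.tan α := Real.tan_pos_of_pos_of_lt_pi_div_two hα0 hα2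
  set t := Real.tan α
  obtain ⟨g, hg⟩ : ∃ g, t ^ 2 * Real.cos α * g =
      2 * (2 * t + b ^ 2 * (6 * t ^ 2 + 8 * t + 3)) + (4 + b ^ 2) :=
    ⟨(2 * (2 * t + b ^ 2 * (6 * t ^ 2 + 8 * t + 3)) + (4 + b ^ 2)) / (t ^ 2 * Real.cos α),
      by field_simp⟩
  have hg' : 0 < t ^ 2 * Real.cos α * g := by rw [hg]; positivity
  have hg0 : 0 < g := pos_of_mul_pos_right hg' (by positivity)
  have hg1 : 4 + b ^ 2 ≤ 2 * t ^ 2 * Real.cos α * g := by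
    have : 0 ≤ 2 * (2 * t + b ^ 2 * (6 * t ^ 2 + 8 * t + 3)) := by positivity
    linarith
  by_cases hdrift : ∃ r : ℝ, ∀ x ∈ S, r ≤ znorm x →
      g ≤ znorm x * mu1 p x ∧ |znorm x * mu2 p x| ≤ 1
  swap
  · refine ⟨g + 1, 1, by linarith, one_pos, fun c hc h₁ h₂ => absurd ?_ hdrift⟩
    obtain ⟨r₁, hr₁⟩ := h₁ 1 one_pos
    obtain ⟨r₂, hr₂⟩ := h₂ 1 one_pos
    exact ⟨max r₁ r₂, fun x hx hxr => ⟨by linarith [hr₁ x hx ((le_max_left _ _).trans hxr)],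
      hr₂ x hx ((le_max_right _ _).trans hxr)⟩⟩
  obtain ⟨r, hr⟩ := hdrift
  set R : ℝ := |r| + b / Real.cos α with hR
  have hR0 : 0 < R := by positivity
  have hbR : b ≤ R * Real.cos α := by
    rw [hR, add_mul, div_mul_cancel₀ _ hcos.ne']
    exact le_add_of_nonneg_left (by positivity)
  have hrR : r ≤ R := (le_abs_self r).trans (le_add_of_nonneg_right (by positivity))
  set K : ℝ := t ^ 2 * (R + 2 * b) ^ 2
  have hK : 0 ≤ K := by positivity
  obtain ⟨M, hM⟩ := exists_nat_gt K
  have hxcos : ∀ y ∈ Wset b α, znorm y * Real.cos α ≤ y.1 := by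
    rintro y (hy | hy)
    · exact hy.2.le
    · linarith [hy.1]
  have hincr : ∀ y ∈ S, y ∈ Wset b α → R ≤ znorm y → ∃ z ∈ jumps b, 0 < p y z ∧
      t ^ 2 * (y.1 : ℝ) ^ 2 - (y.2 : ℝ) ^ 2 + 1 ≤
        t ^ 2 * ((y + z).1 : ℝ) ^ 2 - ((y + z).2 : ℝ) ^ 2 := fun y hyS hyW hyR =>
    exists_jump_quadratic_increase hpmf hA2 ((mem_Wset_iff hα0 hα2 y).1 hyW).1 hcos
      (hxcos y hyW) hg1 hg0.le
      (hr y hyS (hrR.trans hyR)).1 (hr y hyS (hrR.trans hyR)).2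
  have hsub : ∀ y ∈ S, 0 < (y.1 : ℝ) → 0 < potential t K y → b < y.1 ∧
      potential t K y ≤ ∑ z ∈ jumps b, p y z * potential t K (y + z) := by
    intro y hyS hy1 hy
    have hcone := mem_cone_of_potential_pos hy1 hy
    have hfar : R + 2 * b ≤ y.1 := by
      refine le_of_sq_le_sq ?_ hy1.le
      refine le_of_mul_le_mul_left ?_ (by positivity : 0 < t ^ 2)
      linarith [sq_nonneg (y.2 : ℝ)]
    have hyr : r ≤ znorm y := by
      linarith [(le_abs_self _).trans (abs_fst_le_znorm y)]
    exact ⟨by linarith, potential_le_sum_jumps hpmf hA2 htan hK hy1 (by linarith) hcone.le hcos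
      (hxcos y (mem_Wset_of_potential_pos hα0 hα2 hK hy1 hy)) (by linarith [sq_nonneg b]) hg0.le
      (hr y hyS hyr).1 (hr y hyS hyr).2⟩
  refine ⟨g + 1, R + b * M, by linarith, by positivity, fun c _ _ _ x hxW hxA hPx => ?_⟩
  obtain ⟨E, y, hE, hEx, hEy, hPE, hpast, hyW, -, hyq⟩ :=
    exists_event_reaching_cone hα0 hα2 hb.le hinS hMarkov hbR hincr M hxW hxA hPx M le_rfl
  have hy1 := ((mem_Wset_iff hα0 hα2 y).1 hyW).1
  have hy : 0 < potential t K y := by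
    refine mul_pos (Real.sqrt_pos.2 hy1) (sub_pos.2 ((div_lt_iff₀ (by positivity)).2 ?_))
    linarith
  have htop := setLIntegral_exitTime_rpow_eq_top (q := min (1 / 2 + s) 1) hα0 hα2 hb hK
    (lt_min (by linarith) (by norm_num)) (min_le_right _ _) hmeas hinS hMarkov hpmf hA2 hsub
    hE hEy hPE hpast hy1 hy
  rw [← top_le_iff, ← htop]
  refine (lintegral_mono_set hEx).trans
    (setLIntegral_mono_ae' (hmeas 0 (measurableSet_singleton x)) (ae_of_all _ fun ω hω => ?_))
  refine ENNReal.rpow_le_rpow_of_exponent_le (le_iInf₂ fun j hj => ?_) (min_le_left _ _)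
  have hj0 : j ≠ 0 := by
    rintro rfl
    exact hj ((show ξ 0 ω = x from hω) ▸ hxW)
  exact_mod_cast Nat.one_le_iff_ne_zero.2 hj0
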